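/- arXiv:2210.04970 — 18 statements merged into one kernel-verified Lean document; each statement's English description precedes it below -/
import Mathlib

section
/- Let S be a monoid, A an S-act, and B a nonempty fully invariant subact of A. If B (as an S-act) and the Rees quotient A/B are both Hopfian, then A is Hopfian. -/
universe u v w

/-- `act` is a right `S`-act structure on `A`. -/
def IsAct (S : Type v) [Monoid S] {A : Type u} (act : A → S → A) : Prop :=
  (∀ a : A, act a 1 = a) ∧ ∀ (a : A) (s t : S), act (act a s) t = act a (s * t)

/-- `f` is a homomorphism of `S`-acts. -/
def IsActHom (S : Type v) [Monoid S] {A : Type u} {B : Type w}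
    (actA : A → S → A) (actB : B → S → B) (f : A → B) : Prop :=
  ∀ (a : A) (s : S), f (actA a s) = actB (f a) s

/-- An act is Hopfian if every surjective endomorphism is bijective. -/
def ActHopfian (S : Type v) [Monoid S] {A : Type u} (act : A → S → A) : Prop :=
  ∀ f : A → A, IsActHom S act act f → Function.Surjective f → Function.Bijective f

/-- An act is co-Hopfian if every injective endomorphism is bijective. -/
def ActCoHopfian (S : Type v) [Monoid S] {A : Type u} (act : A → S → A) : Prop :=
  ∀ f : A → A, IsActHom S act act f → Function.Injective f → Function.Bijective f

/-- `B` is a subact: a subset closed under the action. -/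
def IsSubact (S : Type v) [Monoid S] {A : Type u} (act : A → S → A) (B : Set A) : Prop :=
  ∀ a ∈ B, ∀ s : S, act a s ∈ B

/-- The induced action on a subact. -/
def subAct (S : Type v) [Monoid S] {A : Type u} (act : A → S → A) (B : Set A)
    (hB : IsSubact S act B) : B → S → B :=
  fun b s => ⟨act b.1 s, hB b.1 b.2 s⟩

/-- The Rees congruence relation determined by a subset `B`. -/
abbrev reesRel {A : Type u} (B : Set A) : A → A → Prop :=
  fun a b => a = b ∨ (a ∈ B ∧ b ∈ B)

/-- The induced action on the Rees quotient `A/B`. -/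
def reesAct (S : Type v) [Monoid S] {A : Type u} (act : A → S → A) (B : Set A)
    (hB : IsSubact S act B) : Quot (reesRel B) → S → Quot (reesRel B) :=
  fun q s => Quot.map (fun a => act a s)
    (fun a b h => by
      rcases h with rfl | ⟨ha, hb⟩
      · exact Or.inl rfl
      · exact Or.inr ⟨hB a ha s, hB b hb s⟩) q

/-- The induced action on the quotient of `A` by a congruence `r`. -/
def congAct (S : Type v) [Monoid S] {A : Type u} (act : A → S → A) (r : A → A → Prop)
    (hr : ∀ a b, r a b → ∀ s : S, r (act a s) (act b s)) : Quot r → S → Quot r :=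
  fun q s => Quot.map (fun a => act a s) (fun a b h => hr a b h s) q

/-- `B` is a large (essential) subact of `A`: any homomorphism out of `A`
injective on `B` is injective. -/
def IsLargeSubact (S : Type v) [Monoid S] {A : Type u} (act : A → S → A) (B : Set A) : Prop :=
  ∀ (C : Type u) (actC : C → S → C), IsAct S actC →
    ∀ g : A → C, IsActHom S act actC g → Set.InjOn g B → Function.Injective g

/-- An act is mono-uniform if images of injective endomorphisms are large. -/
def MonoUniform (S : Type v) [Monoid S] {A : Type u} (act : A → S → A) : Prop :=
  ∀ f : A → A, IsActHom S act act f → Function.Injective f →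
    IsLargeSubact S act (Set.range f)

/-- Rees noetherian: no infinite strictly ascending chain of subacts. -/
def ReesNoetherianAct (S : Type v) [Monoid S] {A : Type u} (act : A → S → A) : Prop :=
  ¬ ∃ c : ℕ → Set A, (∀ n, IsSubact S act (c n)) ∧ ∀ n, c n ⊂ c (n + 1)

/-- Quasi-injective act: homomorphisms from subacts to `A` extend to endomorphisms. -/
def QuasiInjectiveAct (S : Type v) [Monoid S] {A : Type u} (act : A → S → A) : Prop :=
  ∀ (B : Set A) (hB : IsSubact S act B) (f : B → A),
    IsActHom S (subAct S act B hB) act f →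
    ∃ h : A → A, IsActHom S act act h ∧ ∀ b : B, h b.1 = f b

/-- Quasi-projective act. -/
def QuasiProjectiveAct (S : Type v) [Monoid S] {A : Type u} (act : A → S → A) : Prop :=
  ∀ (C : Type u) (actC : C → S → C), IsAct S actC →
    ∀ g : A → C, IsActHom S act actC g → Function.Surjective g →
    ∀ f : A → C, IsActHom S act actC f →
    ∃ h : A → A, IsActHom S act act h ∧ g ∘ h = f

/-- Projective act. -/
def ProjectiveAct (S : Type v) [Monoid S] {P : Type u} (actP : P → S → P) : Prop :=
  ∀ (C : Type u) (actC : C → S → C), IsAct S actC →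
    ∀ (D : Type u) (actD : D → S → D), IsAct S actD →
    ∀ g : C → D, IsActHom S actC actD g → Function.Surjective g →
    ∀ h : P → D, IsActHom S actP actD h →
    ∃ k : P → C, IsActHom S actP actC k ∧ g ∘ k = h

/-- Indecomposable act: not a disjoint union of two proper nonempty subacts. -/
def IndecomposableAct (S : Type v) [Monoid S] {A : Type u} (act : A → S → A) : Prop :=
  ¬ ∃ U V : Set A, IsSubact S act U ∧ IsSubact S act V ∧ U.Nonempty ∧ V.Nonempty ∧
      U ≠ Set.univ ∧ V ≠ Set.univ ∧ Disjoint U V ∧ U ∪ V = Set.univ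

/-- The coproduct (disjoint union) action on `A ⊕ B`. -/
def sumAct (S : Type v) [Monoid S] {A : Type u} {B : Type w}
    (actA : A → S → A) (actB : B → S → B) : A ⊕ B → S → A ⊕ B :=
  fun x s => Sum.map (fun a => actA a s) (fun b => actB b s) x

/-- Quasi-retractable: surjective endomorphisms have right inverse endomorphisms. -/
def QuasiRetractableAct (S : Type v) [Monoid S] {A : Type u} (act : A → S → A) : Prop :=
  ∀ f : A → A, IsActHom S act act f → Function.Surjective f →
    ∃ g : A → A, IsActHom S act act g ∧ f ∘ g = id

/-- Quasi-coretractable: injective endomorphisms have left inverse endomorphisms. -/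
def QuasiCoretractableAct (S : Type v) [Monoid S] {A : Type u} (act : A → S → A) : Prop :=
  ∀ f : A → A, IsActHom S act act f → Function.Injective f →
    ∃ g : A → A, IsActHom S act act g ∧ g ∘ f = id

/-- Strongly co-Hopfian: the chain of images of iterates of any endomorphism stabilizes. -/
def StronglyCoHopfianAct (S : Type v) [Monoid S] {A : Type u} (act : A → S → A) : Prop :=
  ∀ f : A → A, IsActHom S act act f →
    ∃ n : ℕ, 1 ≤ n ∧ Set.range (f^[n]) = Set.range (f^[n + 1])

/-- Strongly Hopfian: the chain of kernels of iterates of any endomorphism stabilizes. -/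
def StronglyHopfianAct (S : Type v) [Monoid S] {A : Type u} (act : A → S → A) : Prop :=
  ∀ f : A → A, IsActHom S act act f →
    ∃ n : ℕ, 1 ≤ n ∧ Setoid.ker (f^[n]) = Setoid.ker (f^[n + 1])

/-- The Rees congruence by a subset `D`, as an equivalence relation (setoid). -/
def reesSetoid {A : Type u} (D : Set A) : Setoid A where
  r a b := a = b ∨ (a ∈ D ∧ b ∈ D)
  iseqv := by
    constructor
    · intro a; exact Or.inl rfl
    · rintro a b (rfl | ⟨ha, hb⟩)
      · exact Or.inl rfl
      · exact Or.inr ⟨hb, ha⟩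
    · rintro a b c (rfl | ⟨ha, hb⟩) (rfl | ⟨hb', hc⟩)
      · exact Or.inl rfl
      · exact Or.inr ⟨hb', hc⟩
      · exact Or.inr ⟨ha, hb⟩
      · exact Or.inr ⟨ha, hc⟩

/-- A Fitting act: for any endomorphism `f` there is `n ≥ 1` with
`ker f^n ∨ ρ_{Im f^n} = ∇` and `ker f^n ∩ ρ_{Im f^n} = Δ`. -/
def FittingAct (S : Type v) [Monoid S] {A : Type u} (act : A → S → A) : Prop :=
  ∀ f : A → A, IsActHom S act act f →
    ∃ n : ℕ, 1 ≤ n ∧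
      Setoid.ker (f^[n]) ⊔ reesSetoid (Set.range (f^[n])) = ⊤ ∧
      Setoid.ker (f^[n]) ⊓ reesSetoid (Set.range (f^[n])) = ⊥

/-- If `B` is a nonempty fully invariant subact of `A` such that `B` and the Rees
quotient `A/B` are Hopfian, then `A` is Hopfian. -/
theorem stmt_0 {S : Type v} [Monoid S] {A : Type u} (act : A → S → A) (hA : IsAct S act)
    (B : Set A) (hBne : B.Nonempty) (hB : IsSubact S act B)
    (hfi : ∀ f : A → A, IsActHom S act act f → ∀ a ∈ B, f a ∈ B)
    (hBHopf : ActHopfian S (subAct S act B hB))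
    (hQHopf : ActHopfian S (reesAct S act B hB)) :
    ActHopfian S act := by
  intro f hf hs
  have hex : ∀ a b : A, Quot.mk (reesRel B) a = Quot.mk (reesRel B) b → reesRel B a b := by
    intro a b h
    exact ((reesSetoid B).iseqv.eqvGen_iff).1 (Quot.eqvGen_exact h)
  have hfB : ∀ a ∈ B, f a ∈ B := hfi f hf
  have hmap : ∀ a b : A, reesRel B a b → reesRel B (f a) (f b) := by
    rintro a b (rfl | ⟨ha, hb⟩)
    · exact Or.inl rfl
    · exact Or.inr ⟨hfB a ha, hfB b hb⟩
  have hq : Function.Injective (Quot.map f hmap) := by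
    refine (hQHopf (Quot.map f hmap) ?_ ?_).1
    · rintro ⟨a⟩ s
      exact congrArg (Quot.mk (reesRel B)) (hf a s)
    · rintro ⟨a⟩
      obtain ⟨c, rfl⟩ := hs a
      exact ⟨Quot.mk _ c, rfl⟩
  have hback : ∀ a, f a ∈ B → a ∈ B := by
    intro a ha
    obtain ⟨b, hb⟩ := hBne
    have h1 : Quot.map f hmap (Quot.mk _ a) = Quot.map f hmap (Quot.mk _ b) :=
      Quot.sound (Or.inr ⟨ha, hfB b hb⟩)
    rcases hex a b (hq h1) with rfl | ⟨h, _⟩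
    · exact hb
    · exact h
  have hr : Function.Injective (fun b : B => (⟨f b.1, hfB b.1 b.2⟩ : B)) := by
    refine (hBHopf _ ?_ ?_).1
    · intro b s
      exact Subtype.ext (hf b.1 s)
    · rintro ⟨b, hb⟩
      obtain ⟨c, rfl⟩ := hs b
      exact ⟨⟨c, hback c hb⟩, rfl⟩
  refine ⟨?_, hs⟩
  intro a b hab
  have h1 : Quot.map f hmap (Quot.mk _ a) = Quot.map f hmap (Quot.mk _ b) :=
    congrArg (Quot.mk (reesRel B)) hab
  rcases hex a b (hq h1) with h | ⟨ha, hb⟩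
  · exact h
  · exact congrArg Subtype.val (@hr ⟨a, ha⟩ ⟨b, hb⟩ (Subtype.ext hab))
end

section
/- Let S be a monoid, A an S-act, and B a nonempty fully invariant subact of A. If B (as an S-act) and the Rees quotient A/B are both co-Hopfian, then A is co-Hopfian. -/
universe u v w

/-- If `B` is a nonempty fully invariant subact of `A` such that `B` and the Rees
quotient `A/B` are co-Hopfian, then `A` is co-Hopfian. -/
theorem stmt_1 {S : Type v} [Monoid S] {A : Type u} (act : A → S → A) (hA : IsAct S act)
    (B : Set A) (hBne : B.Nonempty) (hB : IsSubact S act B)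
    (hfi : ∀ f : A → A, IsActHom S act act f → ∀ a ∈ B, f a ∈ B)
    (hBco : ActCoHopfian S (subAct S act B hB))
    (hQco : ActCoHopfian S (reesAct S act B hB)) :
    ActCoHopfian S act := by
  intro f hf hinj
  have hsurjB : ∀ y ∈ B, ∃ x ∈ B, f x = y := by
    have h := hBco (fun b => ⟨f b.1, hfi f hf b.1 b.2⟩)
      (fun a s => Subtype.ext (hf a.1 s))
      (fun a b hab => Subtype.ext (hinj (congrArg Subtype.val hab)))
    intro y hy
    obtain ⟨x, hx⟩ := h.2 ⟨y, hy⟩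
    exact ⟨x.1, x.2, congrArg Subtype.val hx⟩
  have hback : ∀ a, f a ∈ B → a ∈ B := by
    intro a ha
    obtain ⟨x, hx, hxa⟩ := hsurjB _ ha
    exact hinj hxa ▸ hx
  have hex : ∀ a b : A, Quot.mk (reesRel B) a = Quot.mk (reesRel B) b → reesRel B a b :=
    fun a b h => Quotient.exact (s := reesSetoid B) h
  have hmap : ∀ a b, reesRel B a b → reesRel B (f a) (f b) := by
    rintro a b (rfl | ⟨ha, hb⟩)
    · exact Or.inl rfl
    · exact Or.inr ⟨hfi f hf a ha, hfi f hf b hb⟩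
  have hq := hQco (Quot.map f hmap)
    (by
      rintro ⟨a⟩ s
      exact congrArg (Quot.mk _) (hf a s))
    (by
      rintro ⟨a⟩ ⟨b⟩ hab
      rcases hex _ _ hab with h | ⟨ha, hb⟩
      · exact congrArg (Quot.mk _) (hinj h)
      · exact Quot.sound (Or.inr ⟨hback a ha, hback b hb⟩))
  refine ⟨hinj, fun y => ?_⟩
  obtain ⟨⟨a⟩, ha⟩ := hq.2 (Quot.mk _ y)
  rcases hex _ _ ha with h | ⟨_, hy⟩
  · exact ⟨a, h⟩
  · obtain ⟨x, _, hx⟩ := hsurjB y hy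
    exact ⟨x, hx⟩
end

section
/- Let S be a monoid and let A and B be indecomposable S-acts. Then A and B are both co-Hopfian if and only if the coproduct A ⊔ B is co-Hopfian. -/
universe u v w

theorem indec_split {S : Type v} [Monoid S] {A : Type u} {X : Type*} {Y : Type*}
    (act : A → S → A) (actX : X → S → X) (actY : Y → S → Y)
    (hI : IndecomposableAct S act) (g : A → X ⊕ Y)
    (hg : IsActHom S act (sumAct S actX actY) g) :
    (∃ h : A → X, ∀ a, g a = Sum.inl (h a)) ∨ (∃ h : A → Y, ∀ a, g a = Sum.inr (h a)) := by
  by_cases h1 : ∀ a, ∃ x, g a = Sum.inl x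
  · left; choose h hh using h1; exact ⟨h, hh⟩
  by_cases h2 : ∀ a, ∃ x, g a = Sum.inr x
  · right; choose h hh using h2; exact ⟨h, hh⟩
  exfalso
  push Not at h1 h2
  obtain ⟨a, ha⟩ := h1
  obtain ⟨b, hb⟩ := h2
  apply hI
  refine ⟨{c | ∃ x, g c = Sum.inl x}, {c | ∃ x, g c = Sum.inr x}, ?_, ?_, ?_, ?_, ?_, ?_, ?_, ?_⟩
  · rintro c ⟨x, hx⟩ s
    exact ⟨actX x s, by rw [hg, hx]; rfl⟩
  · rintro c ⟨x, hx⟩ s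
    exact ⟨actY x s, by rw [hg, hx]; rfl⟩
  · refine ⟨b, ?_⟩
    cases hc : g b with
    | inl x => exact ⟨x, hc⟩
    | inr x => exact absurd hc (hb x)
  · refine ⟨a, ?_⟩
    cases hc : g a with
    | inl x => exact absurd hc (ha x)
    | inr x => exact ⟨x, hc⟩
  · intro h
    obtain ⟨x, hx⟩ := h.symm.subset (Set.mem_univ a)
    exact ha x hx
  · intro h
    obtain ⟨x, hx⟩ := h.symm.subset (Set.mem_univ b)
    exact hb x hx
  · rw [Set.disjoint_left]
    rintro c ⟨x, hx⟩ ⟨y, hy⟩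
    rw [hx] at hy
    cases hy
  · ext c
    simp only [Set.mem_union, Set.mem_ofPred_eq, Set.mem_univ, iff_true]
    cases hc : g c with
    | inl x => exact Or.inl ⟨x, rfl⟩
    | inr x => exact Or.inr ⟨x, rfl⟩

/-- For indecomposable acts `A`, `B`: both are co-Hopfian iff `A ⊔ B` is co-Hopfian. -/
theorem stmt_2 {S : Type v} [Monoid S] {A : Type u} {B : Type w}
    (actA : A → S → A) (actB : B → S → B) (hA : IsAct S actA) (hB : IsAct S actB)
    (hIA : IndecomposableAct S actA) (hIB : IndecomposableAct S actB) :
    (ActCoHopfian S actA ∧ ActCoHopfian S actB) ↔ ActCoHopfian S (sumAct S actA actB) := by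
  constructor
  · rintro ⟨cA, cB⟩ f hf inj
    refine ⟨inj, ?_⟩
    have homl : ∀ a s, f (Sum.inl (actA a s)) = sumAct S actA actB (f (Sum.inl a)) s :=
      fun a s => hf (Sum.inl a) s
    have homr : ∀ a s, f (Sum.inr (actB a s)) = sumAct S actA actB (f (Sum.inr a)) s :=
      fun a s => hf (Sum.inr a) s
    rcases indec_split actA actA actB hIA (fun a => f (Sum.inl a)) homl with ⟨g, hg⟩ | ⟨g, hg⟩ <;>
    rcases indec_split actB actA actB hIB (fun a => f (Sum.inr a)) homr with ⟨k, hk⟩ | ⟨k, hk⟩ <;>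
    beta_reduce at hg hk <;>
    simp only [hg, hk, sumAct, Sum.map_inl, Sum.map_inr, Sum.inl.injEq, Sum.inr.injEq]
      at homl homr
    · have gs := (cA g homl (fun x y h => Sum.inl_injective (inj (by rw [hg, hg, h])))).2
      have key : B → False := fun b => by
        obtain ⟨a, ha⟩ := gs (k b)
        have := inj (a₁ := Sum.inl a) (a₂ := Sum.inr b) (by rw [hg, hk, ha])
        cases this
      rintro (a | b)
      · obtain ⟨x, rfl⟩ := gs a
        exact ⟨_, hg x⟩
      · exact (key b).elim
    · have gs := (cA g homl (fun x y h => Sum.inl_injective (inj (by rw [hg, hg, h])))).2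
      have ks := (cB k homr (fun x y h => Sum.inr_injective (inj (by rw [hk, hk, h])))).2
      rintro (a | b)
      · obtain ⟨x, rfl⟩ := gs a
        exact ⟨_, hg x⟩
      · obtain ⟨x, rfl⟩ := ks b
        exact ⟨_, hk x⟩
    · have gi : Function.Injective g :=
        fun x y h => Sum.inl_injective (inj (by rw [hg, hg, h]))
      have ki : Function.Injective k :=
        fun x y h => Sum.inr_injective (inj (by rw [hk, hk, h]))
      have s1 := (cA (k ∘ g) (fun a s => by simp [homl, homr]) (ki.comp gi)).2
      have s2 := (cB (g ∘ k) (fun a s => by simp [homl, homr]) (gi.comp ki)).2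
      rintro (a | b)
      · obtain ⟨x, rfl⟩ := s1 a
        exact ⟨_, hk (g x)⟩
      · obtain ⟨x, rfl⟩ := s2 b
        exact ⟨_, hg (k x)⟩
    · have ks := (cB k homr (fun x y h => Sum.inr_injective (inj (by rw [hk, hk, h])))).2
      have key : A → False := fun a => by
        obtain ⟨b, hb⟩ := ks (g a)
        have := inj (a₁ := Sum.inl a) (a₂ := Sum.inr b) (by rw [hg, hk, hb])
        cases this
      rintro (a | b)
      · exact (key a).elim
      · obtain ⟨x, rfl⟩ := ks b
        exact ⟨_, hk x⟩
  · intro h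
    constructor
    · intro f hf inj
      refine ⟨inj, fun a => ?_⟩
      obtain ⟨x | x, hx⟩ := (h (Sum.map f id)
        (by rintro (a | b) s <;> simp [sumAct, hf _ s])
        (inj.sumMap Function.injective_id)).2 (Sum.inl a)
      · exact ⟨x, Sum.inl_injective hx⟩
      · cases hx
    · intro f hf inj
      refine ⟨inj, fun a => ?_⟩
      obtain ⟨x | x, hx⟩ := (h (Sum.map id f)
        (by rintro (a | b) s <;> simp [sumAct, hf _ s])
        (Function.injective_id.sumMap inj)).2 (Sum.inr a)
      · cases hx
      · exact ⟨x, Sum.inr_injective hx⟩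
end

section
/- Let S be a monoid. Every quasi-retractable co-Hopfian S-act is Hopfian. -/
universe u v w

/-- Every quasi-retractable co-Hopfian act is Hopfian. -/
theorem stmt_3 {S : Type v} [Monoid S] {A : Type u} (act : A → S → A) (hA : IsAct S act)
    (hqr : QuasiRetractableAct S act) (hco : ActCoHopfian S act) :
    ActHopfian S act := by
  intro f hf hs
  obtain ⟨g, hg, hfg⟩ := hqr f hf hs
  have h : ∀ x, f (g x) = x := fun x => congrFun hfg x
  have hgb := hco g hg (Function.LeftInverse.injective h)
  refine ⟨fun a b hab => ?_, hs⟩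
  obtain ⟨x, rfl⟩ := hgb.2 a
  obtain ⟨y, rfl⟩ := hgb.2 b
  rw [h, h] at hab
  rw [hab]
end

section
/- Let S be a monoid. Every quasi-coretractable Hopfian S-act is co-Hopfian. -/
universe u v w

/-- Every quasi-coretractable Hopfian act is co-Hopfian. -/
theorem stmt_4 {S : Type v} [Monoid S] {A : Type u} (act : A → S → A) (hA : IsAct S act)
    (hqc : QuasiCoretractableAct S act) (hH : ActHopfian S act) :
    ActCoHopfian S act := by
  intro f hf hinj
  obtain ⟨g, hg, hgf⟩ := hqc f hf hinj
  have h : ∀ a, g (f a) = a := fun a => congrFun hgf a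
  have hb := hH g hg (fun a => ⟨f a, h a⟩)
  exact ⟨hinj, fun a => ⟨g a, hb.1 (h (g a))⟩⟩
end

section
/- Let S be a monoid and regard S as a right S-act S_S over itself via right multiplication. If S_S is mono-uniform, then S is right Hopfian, i.e., every surjective endomorphism of the S-act S_S is bijective. -/
universe u v w

/-- If the right act `S_S` is mono-uniform, then `S` is right Hopfian. -/
theorem stmt_6 {S : Type u} [Monoid S]
    (h : MonoUniform S (fun a s => a * s : S → S → S)) :
    ActHopfian S (fun a s => a * s : S → S → S) := by
  intro f hf hs
  refine ⟨?_, hs⟩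
  obtain ⟨b, hb⟩ := hs 1
  have key : ∀ s, f (b * s) = s := by
    intro s
    have h1 : f (b * s) = f b * s := hf b s
    rw [h1, hb, one_mul]
  refine h (fun s => b * s) (fun a s => (mul_assoc b a s).symm) ?_ S (fun a s => a * s)
    ⟨fun a => mul_one a, fun a s t => mul_assoc a s t⟩ f hf ?_
  · intro x y hxy
    have h2 : b * x = b * y := hxy
    rw [← key x, h2, key y]
  · rintro _ ⟨x, rfl⟩ _ ⟨y, rfl⟩ hxy
    have h3 : f (b * x) = f (b * y) := hxy
    rw [key, key] at h3
    rw [h3]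
end

section
/- Let S be a monoid and A an S-act with a zero element θ which satisfies the ascending chain condition on subacts (A is Rees noetherian). If B is a nonempty subact of A such that A is isomorphic as an S-act to the Rees quotient A/B, then B is a one-element subact {b} (and b is a zero element of A). -/
universe u v w

/-- If a Rees noetherian act `A` with a zero is isomorphic to a Rees quotient `A/B`
by a nonempty subact `B`, then `B` is a one-element (zero) subact. -/
theorem stmt_7 {S : Type v} [Monoid S] {A : Type u} (act : A → S → A) (hA : IsAct S act)
    (θ : A) (hθ : ∀ s : S, act θ s = θ)
    (hnoeth : ReesNoetherianAct S act)
    (B : Set A) (hBne : B.Nonempty) (hB : IsSubact S act B)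
    (φ : A → Quot (reesRel B)) (hφ : IsActHom S act (reesAct S act B hB) φ)
    (hbij : Function.Bijective φ) :
    ∃ b : A, B = {b} ∧ ∀ s : S, act b s = b := by
  obtain ⟨b0, hb0⟩ := hBne
  obtain ⟨f, hf⟩ : ∃ f : A → A, ∀ a, φ (f a) = Quot.mk _ a :=
    ⟨fun a => (hbij.2 (Quot.mk _ a)).choose, fun a => (hbij.2 (Quot.mk _ a)).choose_spec⟩
  have hhom : ∀ a s, f (act a s) = act (f a) s := by
    intro a s
    apply hbij.1
    rw [hf, hφ, hf]
    rfl
  have hsurj : Function.Surjective f := by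
    intro y
    obtain ⟨a, ha⟩ := Quot.exists_rep (φ y)
    exact ⟨a, hbij.1 (by rw [hf, ha])⟩
  have hfB : ∀ b ∈ B, f b = f b0 := by
    intro b hb
    apply hbij.1
    rw [hf, hf]
    exact Quot.sound (Or.inr ⟨hb, hb0⟩)
  obtain ⟨z, hz⟩ : ∃ z, z = f b0 := ⟨_, rfl⟩
  rw [← hz] at hfB
  have hz0 : ∀ s, act z s = z := by
    intro s
    rw [hz, ← hhom, ← hz]
    exact hfB _ (hB b0 hb0 s)
  have hit : ∀ n a s, f^[n] (act a s) = act (f^[n] a) s := by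
    intro n
    induction n with
    | zero => intro a s; rfl
    | succ n ih => intro a s; rw [Function.iterate_succ_apply', ih, hhom,
        Function.iterate_succ_apply']
  have stab : ∀ c : ℕ → Set A, (∀ n, IsSubact S act (c n)) → (∀ n, c n ⊆ c (n + 1)) →
      ∃ n, c (n + 1) ⊆ c n := by
    intro c h1 h2
    by_contra h3
    push Not at h3
    exact hnoeth ⟨c, h1, fun n => ⟨h2 n, h3 n⟩⟩
  obtain ⟨m, hm⟩ : ∃ m, f^[m + 1] z = z := by
    obtain ⟨n, hn⟩ := stab (fun n => {x | ∃ k, k ≤ n ∧ f^[k] x = z})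
      (by
        rintro n a ⟨k, hk, h⟩ s
        exact ⟨k, hk, by rw [hit, h, hz0]⟩)
      (by
        rintro n a ⟨k, hk, h⟩
        exact ⟨k, by omega, h⟩)
    obtain ⟨x, hx⟩ := hsurj.iterate (n + 1) z
    obtain ⟨k, hk, h⟩ := hn (show x ∈ _ from ⟨n + 1, le_rfl, hx⟩)
    refine ⟨n - k, ?_⟩
    have e : n + 1 = (n - k + 1) + k := by omega
    rw [e, Function.iterate_add_apply, h] at hx
    exact hx
  have hinj : ∀ y, f^[m + 1] y = z → y = z := by
    obtain ⟨n, hn⟩ := stab (fun n => {x | (f^[m + 1])^[n] x = z})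
      (by
        intro n a h s
        simp only [Set.mem_setOf_eq, ← Function.iterate_mul] at h ⊢
        rw [hit, h, hz0])
      (by
        intro n a h
        simp only [Set.mem_setOf_eq] at h ⊢
        rw [Function.iterate_succ_apply', h, hm])
    intro y hy
    obtain ⟨x, hx⟩ := (hsurj.iterate (m + 1)).iterate n y
    have h : (f^[m + 1])^[n] x = z := hn (by
      simp only [Set.mem_setOf_eq]
      rw [Function.iterate_succ_apply', hx, hy])
    rw [← hx, h]
  have hBz : ∀ b ∈ B, b = f^[m] z := by
    intro b hb
    obtain ⟨x, hx⟩ := hsurj.iterate m b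
    have : x = z := hinj x (by rw [Function.iterate_succ_apply', hx, hfB b hb])
    rw [← hx, this]
  have hall : ∀ b ∈ B, b = b0 := fun b hb => (hBz b hb).trans (hBz b0 hb0).symm
  refine ⟨b0, ?_, fun s => hall _ (hB b0 hb0 s)⟩
  ext b
  constructor
  · exact hall b
  · rintro rfl
    exact hb0
end

section
/- Let S be a monoid and A a quasi-injective co-Hopfian S-act with a zero element θ. If B is a large (essential) subact of A containing θ such that the Rees quotient A/B is Rees noetherian, then B is co-Hopfian (as an S-act). -/
universe u v w

/-- If `A` is quasi-injective co-Hopfian with a zero and `B` is a large subact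
(containing the zero) with `A/B` Rees noetherian, then `B` is co-Hopfian. -/
theorem stmt_8 {S : Type v} [Monoid S] {A : Type u} (act : A → S → A) (hA : IsAct S act)
    (hQI : QuasiInjectiveAct S act) (hco : ActCoHopfian S act)
    (θ : A) (hθ : ∀ s : S, act θ s = θ)
    (B : Set A) (hB : IsSubact S act B) (hθB : θ ∈ B)
    (hlarge : IsLargeSubact S act B)
    (hnoeth : ReesNoetherianAct S (reesAct S act B hB)) :
    ActCoHopfian S (subAct S act B hB) := by
  intro f hf hinj
  obtain ⟨h, hh, hext⟩ := hQI B hB (fun b => (f b).1) (fun b s => congrArg Subtype.val (hf b s))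
  have hhinj : Function.Injective h := by
    refine hlarge A act hA h hh ?_
    intro x hx y hy hxy
    have h1 := hext ⟨x, hx⟩
    have h2 := hext ⟨y, hy⟩
    have h3 : f ⟨x, hx⟩ = f ⟨y, hy⟩ := Subtype.ext (by rw [← h1, ← h2]; exact hxy)
    exact congrArg Subtype.val (hinj h3)
  have hsurj : Function.Surjective h := (hco h hh hhinj).2
  have hmap : ∀ x ∈ B, h x ∈ B := fun x hx => by
    rw [hext ⟨x, hx⟩]; exact (f ⟨x, hx⟩).2
  have hmapn : ∀ (n : ℕ), ∀ x ∈ B, h^[n] x ∈ B := by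
    intro n
    induction n with
    | zero => intro x hx; exact hx
    | succ n ih => intro x hx; exact ih _ (hmap x hx)
  have hhomn : ∀ (n : ℕ) (a : A) (s : S), h^[n] (act a s) = act (h^[n] a) s := by
    intro n
    induction n with
    | zero => intro a s; rfl
    | succ n ih =>
      intro a s
      rw [Function.iterate_succ_apply, Function.iterate_succ_apply, hh, ih]
  refine ⟨hinj, ?_⟩
  by_contra hns
  simp only [Function.Surjective, not_forall] at hns
  obtain ⟨b, hb⟩ := hns
  obtain ⟨a, ha⟩ := hsurj b.1
  have haB : a ∉ B := fun haB => hb ⟨⟨a, haB⟩, Subtype.ext (by rw [← hext ⟨a, haB⟩]; exact ha)⟩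
  let P : ℕ → Quot (reesRel B) → Prop := fun n =>
    Quot.lift (fun x => h^[n] x ∈ B) (by
      rintro x y (rfl | ⟨hx, hy⟩)
      · rfl
      · exact propext ⟨fun _ => hmapn n y hy, fun _ => hmapn n x hx⟩)
  refine hnoeth ⟨fun n => {q | P n q}, ?_, ?_⟩
  · intro n q
    induction q using Quot.ind with
    | mk x =>
      intro hx s
      change h^[n] (act x s) ∈ B
      rw [hhomn]
      exact hB _ hx s
  · intro n
    refine ⟨?_, ?_⟩
    · intro q
      induction q using Quot.ind with
      | mk x =>
        intro hx
        change h^[n+1] x ∈ B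
        rw [Function.iterate_succ_apply']
        exact hmap _ hx
    · intro hsub
      obtain ⟨x, hx⟩ := hsurj.iterate n a
      have h1 : P (n+1) (Quot.mk _ x) := by
        change h^[n+1] x ∈ B
        rw [Function.iterate_succ_apply', hx, ha]
        exact b.2
      have h3 : P n (Quot.mk _ x) := @hsub (Quot.mk _ x) h1
      have h2 : h^[n] x ∈ B := h3
      exact haB (hx ▸ h2)
end

section
/- Let S be a monoid and A an S-act. If there is no infinite strictly ascending chain of congruences λ on A such that the quotient act A/λ is not Hopfian, then A is Hopfian. -/
universe u v w

/-- If there is no infinite strictly ascending chain of congruences `λ` on `A`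
with `A/λ` not Hopfian, then `A` is Hopfian. -/
theorem stmt_9 {S : Type v} [Monoid S] {A : Type u} (act : A → S → A) (hA : IsAct S act)
    (h : ¬ ∃ c : ℕ → (A → A → Prop),
      (∀ n, Equivalence (c n)) ∧
      (∀ n, ∀ a b, c n a b → ∀ s : S, c n (act a s) (act b s)) ∧
      (∀ n, (∀ a b, c n a b → c (n + 1) a b) ∧ c n ≠ c (n + 1)) ∧
      (∀ n, ∀ hc : ∀ a b, c n a b → ∀ s : S, c n (act a s) (act b s),
        ¬ ActHopfian S (congAct S act (c n) hc))) :
    ActHopfian S act := by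
  intro f hf hs
  refine ⟨?_, hs⟩
  by_contra hinj
  apply h
  have hit : ∀ (n : ℕ) (a : A) (s : S), f^[n] (act a s) = act (f^[n] a) s := by
    intro n
    induction n with
    | zero => intro a s; rfl
    | succ n ih =>
      intro a s
      rw [Function.iterate_succ_apply, Function.iterate_succ_apply, hf, ih]
  have key : ∀ n : ℕ, ∃ a b : A, f^[n + 1] a = f^[n + 1] b ∧ f^[n] a ≠ f^[n] b := by
    intro n
    simp only [Function.Injective, not_forall] at hinj
    obtain ⟨x, y, hxy, hne⟩ := hinj
    obtain ⟨a, ha⟩ := hs.iterate n x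
    obtain ⟨b, hb⟩ := hs.iterate n y
    refine ⟨a, b, ?_, ?_⟩
    · rw [Function.iterate_succ_apply', Function.iterate_succ_apply', ha, hb, hxy]
    · rw [ha, hb]; exact hne
  have hEq : ∀ n : ℕ, Equivalence (fun a b : A => f^[n] a = f^[n] b) := fun n =>
    ⟨fun _ => rfl, fun h => h.symm, fun h k => h.trans k⟩
  have hmono : ∀ (n : ℕ) (a b : A), f^[n] a = f^[n] b → f^[n + 1] a = f^[n + 1] b := by
    intro n a b hab
    rw [Function.iterate_succ_apply', Function.iterate_succ_apply', hab]
  refine ⟨fun n a b => f^[n] a = f^[n] b, hEq, ?_, ?_, ?_⟩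
  · intro n a b hab s
    change f^[n] _ = f^[n] _
    rw [hit, hit, hab]
  · intro n
    refine ⟨hmono n, fun heq => ?_⟩
    obtain ⟨a, b, h1, h2⟩ := key n
    exact h2 ((congrFun (congrFun heq a) b).mpr h1)
  · intro n hc hH
    obtain ⟨a, b, h1, h2⟩ := key n
    have hB := hH (Quot.map f (fun a b hab => by
      have := hmono n a b hab
      rwa [Function.iterate_succ_apply, Function.iterate_succ_apply] at this))
      (by
        rintro ⟨a⟩ s
        exact congrArg (Quot.mk _) (hf a s))
      (by
        rintro ⟨a⟩
        obtain ⟨a', rfl⟩ := hs a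
        exact ⟨Quot.mk _ a', rfl⟩)
    have h3 : Quot.mk (fun a b : A => f^[n] a = f^[n] b) a = Quot.mk _ b :=
      hB.1 (Quot.sound (r := fun a b : A => f^[n] a = f^[n] b) h1)
    exact h2 (congrArg (Quot.lift (f^[n]) (fun _ _ h => h)) h3)
end

section
/- Let S be a monoid and A a Hopfian S-act. If there is no infinite strictly descending chain of subacts of A each of which is Hopfian (as an S-act), then A is co-Hopfian. -/
universe u v w

/-- The image of a Hopfian act under an injective endomorphism is Hopfian. -/
theorem hopfian_range {S : Type v} [Monoid S] {A : Type u} (act : A → S → A)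
    (hHop : ActHopfian S act) (g : A → A) (hg : IsActHom S act act g)
    (hi : Function.Injective g) (hc : IsSubact S act (Set.range g)) :
    ActHopfian S (subAct S act (Set.range g) hc) := by
  intro φ hφ hs
  have hex : ∀ a : A, ∃ b : A, g b = (φ ⟨g a, a, rfl⟩).1 := fun a => (φ ⟨g a, a, rfl⟩).2
  choose ψ hψ using hex
  have hψhom : IsActHom S act act ψ := by
    intro a s
    apply hi
    rw [hψ, hg (ψ a) s, hψ]
    have h1 := congrArg Subtype.val (hφ ⟨g a, a, rfl⟩ s)
    have h2 : (⟨g (act a s), act a s, rfl⟩ : Set.range g)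
        = subAct S act (Set.range g) hc ⟨g a, a, rfl⟩ s := Subtype.ext (hg a s)
    rw [h2, h1]
    rfl
  have hψs : Function.Surjective ψ := by
    intro b
    obtain ⟨⟨_, a, rfl⟩, hx⟩ := hs ⟨g b, b, rfl⟩
    refine ⟨a, hi ?_⟩
    rw [hψ, hx]
  have hb := hHop ψ hψhom hψs
  refine ⟨?_, hs⟩
  rintro ⟨_, a, rfl⟩ ⟨_, b, rfl⟩ hab
  have : a = b := by
    apply hb.1
    apply hi
    rw [hψ, hψ, hab]
  subst this
  rfl

/-- A Hopfian act with no infinite strictly descending chain of Hopfian subacts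
is co-Hopfian. -/
theorem stmt_10 {S : Type v} [Monoid S] {A : Type u} (act : A → S → A) (hA : IsAct S act)
    (hHop : ActHopfian S act)
    (h : ¬ ∃ c : ℕ → Set A,
      (∀ n, IsSubact S act (c n)) ∧
      (∀ n, c (n + 1) ⊂ c n) ∧
      (∀ n, ∀ hc : IsSubact S act (c n), ActHopfian S (subAct S act (c n) hc))) :
    ActCoHopfian S act := by
  intro f hf hi
  refine ⟨hi, ?_⟩
  by_contra hns
  have hit : ∀ n, IsActHom S act act (f^[n]) := by
    intro n
    induction n with
    | zero => intro a s; rfl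
    | succ k ih =>
      intro a s
      rw [Function.iterate_succ_apply', Function.iterate_succ_apply', ih, hf]
  apply h
  refine ⟨fun n => Set.range (f^[n]), ?_, ?_, ?_⟩
  · rintro n _ ⟨a, rfl⟩ s
    exact ⟨act a s, hit n a s⟩
  · intro n
    refine ⟨?_, ?_⟩
    · rintro _ ⟨a, rfl⟩
      exact ⟨f a, (Function.iterate_succ_apply f n a).symm⟩
    · intro hsub
      apply hns
      intro b
      obtain ⟨a, ha⟩ := hsub ⟨b, rfl⟩
      refine ⟨a, hi.iterate n ?_⟩
      rw [← ha, Function.iterate_succ_apply]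
  · intro n hc
    exact hopfian_range act hHop (f^[n]) (hit n) (hi.iterate n) hc
end

section
/- Let S be a monoid and A an S-act. If there is no infinite strictly descending chain of subacts of A each of which is not large (not essential) in A, then A is mono-uniform. -/
universe u v w

/-- An act with no infinite strictly descending chain of non-large subacts is
mono-uniform. -/
theorem stmt_11 {S : Type v} [Monoid S] {A : Type u} (act : A → S → A) (hA : IsAct S act)
    (h : ¬ ∃ c : ℕ → Set A,
      (∀ n, IsSubact S act (c n)) ∧
      (∀ n, c (n + 1) ⊂ c n) ∧
      (∀ n, ¬ IsLargeSubact S act (c n))) :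
    MonoUniform S act := by
  intro f hf hinj
  by_contra hl
  apply h
  have hit : ∀ n, IsActHom S act act (f^[n]) := by
    intro n
    induction n with
    | zero => intro a s; rfl
    | succ k ih =>
      intro a s
      rw [Function.iterate_succ_apply, Function.iterate_succ_apply, hf, ih]
  have hns : ∃ b, b ∉ Set.range f := by
    by_contra hc
    push Not at hc
    apply hl
    intro C actC _ g _ hg x y hxy
    exact hg (hc x) (hc y) hxy
  obtain ⟨b, hb⟩ := hns
  refine ⟨fun n => Set.range (f^[n + 1]), ?_, ?_, ?_⟩
  · rintro n _ ⟨a, rfl⟩ s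
    exact ⟨act a s, hit _ a s⟩
  · intro n
    refine ⟨?_, ?_⟩
    · rintro _ ⟨a, rfl⟩
      exact ⟨f a, rfl⟩
    · intro hsub
      obtain ⟨a, ha⟩ := hsub ⟨b, rfl⟩
      rw [Function.iterate_succ_apply] at ha
      exact hb ⟨a, hinj.iterate (n + 1) ha⟩
  · intro n hn
    apply hl
    intro C actC hC g hg hgi
    apply hn C actC hC g hg
    apply hgi.mono
    rintro _ ⟨a, rfl⟩
    exact ⟨f^[n] a, (Function.iterate_succ_apply' f n a).symm⟩
end

section
/- Let S be a monoid and A a torsion free S-act with a zero element. Then A is co-Hopfian if and only if A is both mono-uniform and quasi-coretractable. -/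
universe u v w

/-- A torsion free act with a zero is co-Hopfian iff it is mono-uniform and
quasi-coretractable. -/
theorem stmt_12 {S : Type v} [Monoid S] {A : Type u} (act : A → S → A) (hA : IsAct S act)
    (htf : ∀ (a b : A) (s : S), act a s = act b s → a = b)
    (θ : A) (hθ : ∀ s : S, act θ s = θ) :
    ActCoHopfian S act ↔ (MonoUniform S act ∧ QuasiCoretractableAct S act) := by
  constructor
  · intro h
    refine ⟨?_, ?_⟩
    · intro f hf hi C actC _ g _ hinj
      have hs := (h f hf hi).2
      rw [hs.range_eq] at hinj
      exact Set.injOn_univ.mp hinj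
    · intro f hf hi
      obtain ⟨g, hgf, hfg⟩ := Function.bijective_iff_has_inverse.mp (h f hf hi)
      refine ⟨g, ?_, funext hgf⟩
      intro a s
      apply hi
      rw [hfg, hf, hfg]
  · rintro ⟨hm, hq⟩ f hf hi
    obtain ⟨g, hg, hgf⟩ := hq f hf hi
    have hgf' : ∀ a, g (f a) = a := fun a => congrFun hgf a
    have hginj : Function.Injective g := by
      apply hm f hf hi A act hA g hg
      rintro _ ⟨x, rfl⟩ _ ⟨y, rfl⟩ hxy
      rw [hgf', hgf'] at hxy
      rw [hxy]
    exact ⟨hi, fun a => ⟨g a, hginj (hgf' (g a))⟩⟩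
end

section
/- Let S be a monoid and A an S-act. Then A is strongly co-Hopfian (for every endomorphism f of A there exists n ≥ 1 with Im f^n = Im f^{n+1}) if and only if for every endomorphism f of A there exists n ≥ 1 such that the join, in the lattice of equivalence relations on A, of ker f^n and the Rees congruence ρ_{Im f^n} is the full relation A × A. -/
universe u v w

/-- `A` is strongly co-Hopfian iff for every endomorphism `f` there is `n ≥ 1`
with `ker f^n ∨ ρ_{Im f^n} = ∇_A` (join in the lattice of equivalence relations). -/
theorem stmt_13 {S : Type v} [Monoid S] {A : Type u} (act : A → S → A) (hA : IsAct S act) :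
    StronglyCoHopfianAct S act ↔
      ∀ f : A → A, IsActHom S act act f →
        ∃ n : ℕ, 1 ≤ n ∧ Setoid.ker (f^[n]) ⊔ reesSetoid (Set.range (f^[n])) = ⊤ := by
  have _ := hA
  constructor
  · intro h f hf
    obtain ⟨n, hn, he⟩ := h f hf
    refine ⟨n, hn, ?_⟩
    -- the images are stable from n on
    have hstab : ∀ k, ∀ a, ∃ b, f^[n] a = f^[n + k] b := by
      intro k
      induction k with
      | zero => exact fun a => ⟨a, rfl⟩
      | succ k ih =>
        intro a
        obtain ⟨b, hb⟩ := ih a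
        have hmem : f^[n] b ∈ Set.range (f^[n + 1]) := he ▸ Set.mem_range_self b
        obtain ⟨c, hc⟩ := hmem
        refine ⟨c, ?_⟩
        rw [hb, Nat.add_comm n k, Function.iterate_add_apply, ← hc,
          ← Function.iterate_add_apply]
        exact congrArg (fun m => f^[m] c) (by omega)
    set r := Setoid.ker (f^[n]) ⊔ reesSetoid (Set.range (f^[n])) with hr
    have hk : ∀ a, ∃ b, r a (f^[n] b) := by
      intro a
      obtain ⟨b, hb⟩ := hstab n a
      refine ⟨b, ?_⟩
      have hle : Setoid.ker (f^[n]) ≤ r := le_sup_left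
      apply hle
      rw [Setoid.ker_def, hb, Function.iterate_add_apply]
    rw [Setoid.eq_top_iff]
    intro a b
    obtain ⟨a', ha⟩ := hk a
    obtain ⟨b', hb⟩ := hk b
    have hle : reesSetoid (Set.range (f^[n])) ≤ r := le_sup_right
    have hm : r (f^[n] a') (f^[n] b') := hle (Or.inr ⟨⟨a', rfl⟩, ⟨b', rfl⟩⟩)
    exact r.trans' ha (r.trans' hm (r.symm' hb))
  · intro h f hf
    obtain ⟨n, hn, he⟩ := h f hf
    refine ⟨n, hn, ?_⟩
    have hle : Setoid.ker (f^[n]) ⊔ reesSetoid (Set.range (f^[n])) ≤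
        Setoid.comap (f^[n]) (reesSetoid (Set.range (f^[n] ∘ f^[n]))) := by
      apply sup_le
      · intro a b hab
        exact Or.inl hab
      · rintro a b (rfl | ⟨⟨a', rfl⟩, ⟨b', rfl⟩⟩)
        · exact Or.inl rfl
        · exact Or.inr ⟨⟨a', rfl⟩, ⟨b', rfl⟩⟩
    rw [he] at hle
    apply Set.Subset.antisymm
    · rintro _ ⟨a, rfl⟩
      have hmem : ∃ b, f^[n] (f^[n] b) = f^[n] a := by
        have htop : (⊤ : Setoid A) a (f^[n] a) := trivial
        rcases hle htop with heq | ⟨⟨b, hb⟩, _⟩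
        · exact ⟨a, heq.symm⟩
        · exact ⟨b, hb⟩
      obtain ⟨b, hb⟩ := hmem
      refine ⟨f^[n - 1] b, ?_⟩
      rw [← hb, ← Function.iterate_add_apply, ← Function.iterate_add_apply]
      exact congrArg (fun m => f^[m] b) (by omega)
    · rintro _ ⟨a, rfl⟩
      exact ⟨f a, rfl⟩
end

section
/- Let S be a monoid and A an S-act. Then A is Fitting if and only if A is both strongly Hopfian and strongly co-Hopfian. -/
universe u v w

theorem ker_stable {A : Type u} (f : A → A) (n : ℕ)
    (h : Setoid.ker (f^[n]) = Setoid.ker (f^[n + 1])) (k : ℕ) :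
    ∀ a b, f^[n + k] a = f^[n + k] b → f^[n] a = f^[n] b := by
  have h' : ∀ a b, f^[n + 1] a = f^[n + 1] b → f^[n] a = f^[n] b := by
    intro a b hab
    have : (Setoid.ker (f^[n + 1])) a b := hab
    rw [← h] at this
    exact this
  induction k with
  | zero => intro a b hab; exact hab
  | succ k ih =>
    intro a b hab
    apply ih
    rw [Function.iterate_add_apply, Function.iterate_add_apply]
    apply h'
    rw [← Function.iterate_add_apply, ← Function.iterate_add_apply]
    have e : n + 1 + k = n + (k + 1) := by omega
    rw [e]; exact hab

theorem range_stable {A : Type u} (f : A → A) (n : ℕ)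
    (h : Set.range (f^[n]) = Set.range (f^[n + 1])) (k : ℕ) :
    ∀ a, ∃ b, f^[n] a = f^[n + k] b := by
  induction k with
  | zero => intro a; exact ⟨a, rfl⟩
  | succ k ih =>
    intro a
    obtain ⟨b, hb⟩ := ih a
    have : f^[n] b ∈ Set.range (f^[n + 1]) := h ▸ ⟨b, rfl⟩
    obtain ⟨c, hc⟩ := this
    refine ⟨c, ?_⟩
    have e : n + (k + 1) = k + (n + 1) := by omega
    rw [hb, e, Function.iterate_add_apply f k (n + 1), hc, ← Function.iterate_add_apply,
      Nat.add_comm]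

theorem join_image {A : Type u} (g : A → A)
    (h : Setoid.ker g ⊔ reesSetoid (Set.range g) = ⊤) (a : A) : ∃ b, g a = g (g b) := by
  let r : Setoid A := Setoid.comap g
    (reesSetoid {x | ∃ b, x = g (g b)})
  have hle : Setoid.ker g ⊔ reesSetoid (Set.range g) ≤ r := by
    apply sup_le
    · intro x y hxy
      exact Or.inl hxy
    · rintro x y (rfl | ⟨⟨c, rfl⟩, ⟨d, rfl⟩⟩)
      · exact Or.inl rfl
      · exact Or.inr ⟨⟨c, rfl⟩, ⟨d, rfl⟩⟩
  rw [h] at hle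
  have hr : r a (g a) := hle trivial
  rcases hr with hr | ⟨hr, _⟩
  · exact ⟨a, hr⟩
  · exact hr

/-- `A` is a Fitting act iff it is both strongly Hopfian and strongly co-Hopfian. -/
theorem stmt_14 {S : Type v} [Monoid S] {A : Type u} (act : A → S → A) (hA : IsAct S act) :
    FittingAct S act ↔ (StronglyHopfianAct S act ∧ StronglyCoHopfianAct S act) := by
  constructor
  · intro hF
    constructor
    · intro f hf
      obtain ⟨n, hn, _, hm⟩ := hF f hf
      refine ⟨n, hn, ?_⟩
      ext a b
      constructor
      · intro hab
        have hab' : f^[n] a = f^[n] b := hab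
        change f^[n + 1] a = f^[n + 1] b
        rw [Function.iterate_succ_apply', Function.iterate_succ_apply', hab']
      · intro hab
        have hab' : f^[n + 1] a = f^[n + 1] b := hab
        have e : n + n = (n - 1) + (n + 1) := by omega
        have h2 : f^[n] (f^[n] a) = f^[n] (f^[n] b) := by
          rw [← Function.iterate_add_apply, ← Function.iterate_add_apply, e,
            Function.iterate_add_apply f (n - 1) (n + 1) a,
            Function.iterate_add_apply f (n - 1) (n + 1) b, hab']
        have h3 : (Setoid.ker (f^[n]) ⊓ reesSetoid (Set.range (f^[n]))) (f^[n] a) (f^[n] b) :=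
          ⟨h2, Or.inr ⟨⟨a, rfl⟩, ⟨b, rfl⟩⟩⟩
        rw [hm] at h3
        exact h3
    · intro f hf
      obtain ⟨n, hn, hj, _⟩ := hF f hf
      refine ⟨n, hn, ?_⟩
      apply Set.Subset.antisymm
      · rintro _ ⟨a, rfl⟩
        obtain ⟨b, hb⟩ := join_image _ hj a
        refine ⟨f^[n - 1] b, ?_⟩
        have e : n + n = (n + 1) + (n - 1) := by omega
        rw [hb, ← Function.iterate_add_apply, ← Function.iterate_add_apply, e]
      · rintro _ ⟨a, rfl⟩
        exact ⟨f a, rfl⟩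
  · rintro ⟨hH, hC⟩ f hf
    obtain ⟨n, hn, hk⟩ := hH f hf
    obtain ⟨m, hm, hi⟩ := hC f hf
    have hinj : ∀ a b, f^[n + m] (f^[n + m] a) = f^[n + m] (f^[n + m] b) →
        f^[n + m] a = f^[n + m] b := by
      intro a b hab
      rw [← Function.iterate_add_apply, ← Function.iterate_add_apply, Nat.add_assoc] at hab
      have := ker_stable f n hk _ a b hab
      rw [Nat.add_comm, Function.iterate_add_apply, Function.iterate_add_apply, this]
    have him : ∀ a, ∃ b, f^[n + m] a = f^[n + m] (f^[n + m] b) := by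
      intro a
      obtain ⟨b, hb⟩ := range_stable f m hi (n + m) a
      refine ⟨b, ?_⟩
      rw [Function.iterate_add_apply f n m a, hb, ← Function.iterate_add_apply,
        ← Function.iterate_add_apply, Nat.add_assoc]
    refine ⟨n + m, by omega, ?_, ?_⟩
    · rw [eq_top_iff]
      intro a b _
      obtain ⟨c, hc⟩ := him a
      obtain ⟨d, hd⟩ := him b
      have h1 : Setoid.ker (f^[n + m]) ≤
        Setoid.ker (f^[n + m]) ⊔ reesSetoid (Set.range (f^[n + m])) := le_sup_left
      have h2 : reesSetoid (Set.range (f^[n + m])) ≤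
        Setoid.ker (f^[n + m]) ⊔ reesSetoid (Set.range (f^[n + m])) := le_sup_right
      exact Setoid.trans' _ (h1 hc) (Setoid.trans' _
        (h2 (Or.inr ⟨⟨c, rfl⟩, ⟨d, rfl⟩⟩)) (Setoid.symm' _ (h1 hd)))
    · rw [eq_bot_iff]
      rintro a b ⟨h1, h2⟩
      rcases h2 with h2 | ⟨⟨c, rfl⟩, ⟨d, rfl⟩⟩
      · exact h2
      · exact hinj c d h1
end

section
/- Let S be a monoid and A an S-act which is noetherian (no infinite strictly ascending chain of congruences on A) and Rees artinian (no infinite strictly descending chain of subacts of A). Then A is a Fitting S-act. -/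
universe u v w

/-- A noetherian (a.c.c. on congruences) and Rees artinian (d.c.c. on subacts)
act is Fitting. -/
theorem stmt_15 {S : Type v} [Monoid S] {A : Type u} (act : A → S → A) (hA : IsAct S act)
    (hnoeth : ¬ ∃ c : ℕ → (A → A → Prop),
      (∀ n, Equivalence (c n)) ∧
      (∀ n, ∀ a b, c n a b → ∀ s : S, c n (act a s) (act b s)) ∧
      (∀ n, (∀ a b, c n a b → c (n + 1) a b) ∧ c n ≠ c (n + 1)))
    (hart : ¬ ∃ c : ℕ → Set A,
      (∀ n, IsSubact S act (c n)) ∧ ∀ n, c (n + 1) ⊂ c n) :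
    FittingAct S act := by
  intro f hf
  have hfi : ∀ n a s, f^[n] (act a s) = act (f^[n] a) s := by
    intro n
    induction n with
    | zero => intro a s; rfl
    | succ k ih => intro a s; rw [Function.iterate_succ_apply', ih, hf, Function.iterate_succ_apply']
  have h1 : ∃ n, ∀ x, ∃ y, f^[n] x = f^[n+1] y := by
    by_contra hcon
    push Not at hcon
    apply hart
    refine ⟨fun n => Set.range (f^[n]), ?_, ?_⟩
    · rintro n _ ⟨x, rfl⟩ s
      exact ⟨act x s, hfi n x s⟩
    · intro n
      refine ⟨?_, ?_⟩
      · rintro _ ⟨x, rfl⟩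
        exact ⟨f x, (Function.iterate_succ_apply f n x).symm⟩
      · intro h
        obtain ⟨x, hx⟩ := hcon n
        obtain ⟨y, hy⟩ := h ⟨x, rfl⟩
        exact hx y hy.symm
  have h2 : ∃ m, ∀ a b, f^[m+1] a = f^[m+1] b → f^[m] a = f^[m] b := by
    by_contra hcon
    push Not at hcon
    apply hnoeth
    refine ⟨fun n a b => f^[n] a = f^[n] b, ?_, ?_, ?_⟩
    · intro n
      exact ⟨fun _ => rfl, fun h => h.symm, fun h h' => h.trans h'⟩
    · intro n a b h s
      show f^[n] (act a s) = f^[n] (act b s)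
      rw [hfi, hfi]
      exact congrArg (fun z => act z s) h
    · intro n
      refine ⟨?_, ?_⟩
      · intro a b h
        show f^[n+1] a = f^[n+1] b
        rw [Function.iterate_succ_apply', Function.iterate_succ_apply']
        exact congrArg f h
      · intro h
        obtain ⟨a, b, hab, hne⟩ := hcon n
        have h' := congrFun (congrFun h a) b
        exact hne (h'.symm.mp hab)
  obtain ⟨n, hn⟩ := h1
  obtain ⟨m, hm⟩ := h2
  have hn' : ∀ j x, ∃ y, f^[n] x = f^[n+j] y := by
    intro j
    induction j with
    | zero => intro x; exact ⟨x, rfl⟩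
    | succ k ih =>
      intro x
      obtain ⟨y, hy⟩ := ih x
      obtain ⟨z, hz⟩ := hn y
      refine ⟨z, ?_⟩
      rw [hy, Nat.add_comm n k, Function.iterate_add_apply, hz, ← Function.iterate_add_apply]
      exact congrArg (fun i => f^[i] z) (by omega)
  have hm' : ∀ j a b, f^[m+j] a = f^[m+j] b → f^[m] a = f^[m] b := by
    intro j
    induction j with
    | zero => intro a b h; exact h
    | succ k ih =>
      intro a b h
      apply hm
      rw [Function.iterate_succ_apply, Function.iterate_succ_apply]
      apply ih
      rw [← Function.iterate_succ_apply, ← Function.iterate_succ_apply]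
      exact h
  have hR : ∀ x, ∃ y, f^[n+m+1] x = f^[n+m+1] (f^[n+m+1] y) := by
    intro x
    obtain ⟨y, hy⟩ := hn' (n+m+1) x
    refine ⟨y, ?_⟩
    have e : n + m + 1 = (m+1) + n := by omega
    rw [← Function.iterate_add_apply]
    conv_lhs => rw [e, Function.iterate_add_apply, hy, ← Function.iterate_add_apply]
    exact congrArg (fun i => f^[i] y) (by omega)
  have hK : ∀ a b, f^[n+m+1] (f^[n+m+1] a) = f^[n+m+1] (f^[n+m+1] b) →
      f^[n+m+1] a = f^[n+m+1] b := by
    intro a b h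
    rw [← Function.iterate_add_apply, ← Function.iterate_add_apply] at h
    have e : (n+m+1) + (n+m+1) = m + (n+1+(n+m+1)) := by omega
    rw [e] at h
    have h' := hm' _ a b h
    have e' : n + m + 1 = (n+1) + m := by omega
    rw [e', Function.iterate_add_apply f (n+1) m a, Function.iterate_add_apply f (n+1) m b, h']
  refine ⟨n+m+1, by omega, ?_, ?_⟩
  · rw [eq_top_iff]
    intro a b _
    obtain ⟨y, hy⟩ := hR a
    obtain ⟨z, hz⟩ := hR b
    have l : Setoid.ker (f^[n+m+1]) ≤ Setoid.ker (f^[n+m+1]) ⊔ reesSetoid (Set.range (f^[n+m+1])) :=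
      le_sup_left
    have r : reesSetoid (Set.range (f^[n+m+1])) ≤
        Setoid.ker (f^[n+m+1]) ⊔ reesSetoid (Set.range (f^[n+m+1])) := le_sup_right
    have s1 := l (x := a) (y := f^[n+m+1] y) hy
    have s2 := r (x := f^[n+m+1] y) (y := f^[n+m+1] z) (Or.inr ⟨⟨y, rfl⟩, ⟨z, rfl⟩⟩)
    have s3 := l (x := f^[n+m+1] z) (y := b) hz.symm
    exact Setoid.trans' _ s1 (Setoid.trans' _ s2 s3)
  · rw [eq_bot_iff]
    rintro a b ⟨h, rfl | ⟨⟨x, rfl⟩, ⟨y, rfl⟩⟩⟩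
    · rfl
    · exact hK x y h
end

section
/- Let S be a monoid and A a quasi-projective S-act. Then A is strongly co-Hopfian (for every endomorphism f of A there exists n ≥ 1 with Im f^n = Im f^{n+1}) if and only if for every endomorphism f of A there exist n ≥ 1 and an endomorphism γ of A such that f^n = f^{n+1} ∘ γ. -/
universe u v w

/-- A quasi-projective act is strongly co-Hopfian iff for every endomorphism `f`
there are `n ≥ 1` and an endomorphism `γ` with `f^n = f^{n+1} ∘ γ`. -/
theorem stmt_16 {S : Type v} [Monoid S] {A : Type u} (act : A → S → A) (hA : IsAct S act)
    (hqp : QuasiProjectiveAct S act) :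
    StronglyCoHopfianAct S act ↔
      ∀ f : A → A, IsActHom S act act f →
        ∃ n : ℕ, 1 ≤ n ∧ ∃ γ : A → A, IsActHom S act act γ ∧ f^[n] = f^[n + 1] ∘ γ := by
  have hit : ∀ f : A → A, IsActHom S act act f → ∀ n : ℕ, IsActHom S act act (f^[n]) := by
    intro f hf n
    induction n with
    | zero => intro a s; rfl
    | succ k ih =>
      intro a s
      rw [Function.iterate_succ_apply', Function.iterate_succ_apply', ih a s, hf]
  constructor
  · intro h f hf
    obtain ⟨n, hn, hr⟩ := h f hf
    refine ⟨n, hn, ?_⟩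
    have hB : IsSubact S act (Set.range (f^[n + 1])) := by
      rintro _ ⟨a, rfl⟩ s
      exact ⟨act a s, hit f hf (n + 1) a s⟩
    have hmem : ∀ a, f^[n] a ∈ Set.range (f^[n + 1]) := fun a => hr ▸ ⟨a, rfl⟩
    obtain ⟨γ, hγ, he⟩ := hqp (Set.range (f^[n + 1])) (subAct S act _ hB)
      ⟨fun a => Subtype.ext (hA.1 a.1), fun a s t => Subtype.ext (hA.2 a.1 s t)⟩
      (fun a => ⟨f^[n + 1] a, a, rfl⟩)
      (fun a s => Subtype.ext (hit f hf (n + 1) a s))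
      (by rintro ⟨_, a, rfl⟩; exact ⟨a, rfl⟩)
      (fun a => ⟨f^[n] a, hmem a⟩)
      (fun a s => Subtype.ext (hit f hf n a s))
    refine ⟨γ, hγ, ?_⟩
    funext a
    exact (congrArg Subtype.val (congrFun he a)).symm
  · intro h f hf
    obtain ⟨n, hn, γ, hγ, he⟩ := h f hf
    refine ⟨n, hn, Set.Subset.antisymm ?_ ?_⟩
    · rintro _ ⟨a, rfl⟩
      exact ⟨γ a, (congrFun he a).symm⟩
    · rintro _ ⟨a, rfl⟩
      exact ⟨f a, (Function.iterate_succ_apply f n a).symm⟩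
end

section
/- Let S be a monoid and A a finitely generated S-act. Then every factor act of A is co-Hopfian (i.e., for every congruence λ on A the quotient act A/λ is co-Hopfian) if and only if every factor act of A is strongly co-Hopfian. -/
universe u v w

/-- For a finitely generated act `A`: all factor acts of `A` are co-Hopfian iff
all factor acts of `A` are strongly co-Hopfian. -/
theorem stmt_18 {S : Type v} [Monoid S] {A : Type u} (act : A → S → A) (hA : IsAct S act)
    (hfg : ∃ X : Finset A, ∀ a : A, ∃ x ∈ X, ∃ s : S, act x s = a) :
    (∀ r : A → A → Prop, Equivalence r →
      ∀ hr : ∀ a b, r a b → ∀ s : S, r (act a s) (act b s),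
        ActCoHopfian S (congAct S act r hr)) ↔
    (∀ r : A → A → Prop, Equivalence r →
      ∀ hr : ∀ a b, r a b → ∀ s : S, r (act a s) (act b s),
        StronglyCoHopfianAct S (congAct S act r hr)) := by
  constructor
  · intro H r he hr f hf
    obtain ⟨X, hX⟩ := hfg
    let B := congAct S act r hr
    have hfn : ∀ n q s, f^[n] (B q s) = B (f^[n] q) s := by
      intro n
      induction n with
      | zero => intro q s; rfl
      | succ k ih =>
        intro q s
        rw [Function.iterate_succ_apply', Function.iterate_succ_apply', ih]
        exact hf _ s
    have up : ∀ m n : ℕ, m ≤ n → ∀ p q, f^[m] p = f^[m] q → f^[n] p = f^[n] q := by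
      intro m n hmn p q h
      obtain ⟨k, rfl⟩ := Nat.exists_eq_add_of_le' hmn
      rw [Function.iterate_add_apply, Function.iterate_add_apply, h]
    let r' : A → A → Prop := fun a b => ∃ n, f^[n] (Quot.mk r a) = f^[n] (Quot.mk r b)
    have he' : Equivalence r' := by
      refine ⟨fun a => ⟨0, rfl⟩, fun ⟨n, h⟩ => ⟨n, h.symm⟩, ?_⟩
      rintro a b c ⟨n, h⟩ ⟨m, h'⟩
      exact ⟨max n m, (up n _ (le_max_left _ _) _ _ h).trans (up m _ (le_max_right _ _) _ _ h')⟩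
    have hr' : ∀ a b, r' a b → ∀ s : S, r' (act a s) (act b s) := by
      rintro a b ⟨n, h⟩ s
      refine ⟨n, ?_⟩
      have h1 := hfn n (Quot.mk r a) s
      have h2 := hfn n (Quot.mk r b) s
      rw [h, ← h2] at h1
      exact h1
    let g : Quot r → Quot r' := Quot.lift (Quot.mk r')
      (fun a b h => Quot.sound ⟨0, Quot.sound h⟩)
    have hg : ∀ p q, g p = g q ↔ ∃ n, f^[n] p = f^[n] q := by
      rintro ⟨a⟩ ⟨b⟩
      exact he'.quot_mk_eq_iff a b
    have hgs : ∀ p, ∃ q, g q = p := by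
      rintro ⟨a⟩
      exact ⟨Quot.mk r a, rfl⟩
    have hgh : ∀ p s, g (B p s) = congAct S act r' hr' (g p) s := by
      rintro ⟨a⟩ s
      rfl
    have hsucc : ∀ p q, g p = g q → g (f p) = g (f q) := by
      intro p q h
      obtain ⟨n, h⟩ := (hg p q).1 h
      refine (hg _ _).2 ⟨n, ?_⟩
      rw [← Function.iterate_succ_apply, ← Function.iterate_succ_apply]
      exact up n (n + 1) (Nat.le_succ n) _ _ h
    let f' : Quot r' → Quot r' := Quot.lift (fun a => g (f (Quot.mk r a)))
      (fun a b h => hsucc _ _ ((hg _ _).2 h))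
    have hf'g : ∀ p, f' (g p) = g (f p) := by
      rintro ⟨a⟩
      rfl
    have hbij := H r' he' hr' f' (by
      intro q s
      obtain ⟨p, rfl⟩ := hgs q
      rw [← hgh, hf'g, hf'g, ← hgh]
      exact congrArg g (hf p s)) (by
      intro q q' h
      obtain ⟨p, rfl⟩ := hgs q
      obtain ⟨p', rfl⟩ := hgs q'
      rw [hf'g, hf'g] at h
      obtain ⟨n, h⟩ := (hg _ _).1 h
      exact (hg _ _).2 ⟨n + 1, h⟩)
    have key : ∀ x : A, ∃ n, ∃ y, f^[n] (Quot.mk r x) = f^[n] (f y) := by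
      intro x
      obtain ⟨q, hq⟩ := hbij.2 (g (Quot.mk r x))
      obtain ⟨y, rfl⟩ := hgs q
      rw [hf'g] at hq
      obtain ⟨n, h⟩ := (hg (f y) (Quot.mk r x)).1 hq
      exact ⟨n, y, h.symm⟩
    choose N Y hN using key
    refine ⟨X.sup N + 1, Nat.le_add_left _ _, Set.Subset.antisymm ?_ ?_⟩
    · rintro _ ⟨⟨a⟩, rfl⟩
      obtain ⟨x, hx, s, rfl⟩ := hX a
      refine ⟨B (Y x) s, ?_⟩
      have h := up (N x) (X.sup N + 1) ((Finset.le_sup hx).trans (Nat.le_succ _)) _ _ (hN x)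
      rw [hfn, Function.iterate_succ_apply, ← h]
      exact (hfn _ (Quot.mk r x) s).symm
    · rintro _ ⟨a, rfl⟩
      exact ⟨f a, rfl⟩
  · intro H r he hr f hf hinj
    refine ⟨hinj, fun b => ?_⟩
    obtain ⟨n, -, h⟩ := H r he hr f hf
    obtain ⟨c, hc⟩ : f^[n] b ∈ Set.range f^[n + 1] := h ▸ ⟨b, rfl⟩
    exact ⟨c, hinj.iterate n hc⟩
end

section
/- Let S be a monoid and regard S as a right S-act S_S over itself via right multiplication. Then S_S is strongly co-Hopfian if and only if for all elements z, x ∈ S there exist an element t ∈ S and a natural number n ≥ 1 such that x^n·z = x^{n+1}·t. -/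
universe u v w

/-- `S_S` is strongly co-Hopfian iff for all `z, x ∈ S` there exist `t ∈ S` and
`n ≥ 1` with `x^n z = x^{n+1} t`. -/
theorem stmt_19 {S : Type u} [Monoid S] :
    StronglyCoHopfianAct S (fun a s => a * s : S → S → S) ↔
      ∀ z x : S, ∃ t : S, ∃ n : ℕ, 1 ≤ n ∧ x ^ n * z = x ^ (n + 1) * t := by
  have key : ∀ (x : S) (n : ℕ) (y : S), (fun s => x * s)^[n] y = x ^ n * y := by
    intro x n
    induction n with
    | zero => intro y; simp
    | succ k ih => intro y; rw [Function.iterate_succ_apply, ih, pow_succ, mul_assoc]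
  constructor
  · intro h z x
    obtain ⟨n, hn, he⟩ := h (fun s => x * s) (fun a s => (mul_assoc x a s).symm)
    have hm : (fun s => x * s)^[n] z ∈ Set.range ((fun s => x * s)^[n + 1]) := by
      rw [← he]; exact ⟨z, rfl⟩
    obtain ⟨t, ht⟩ := hm
    rw [key, key] at ht
    exact ⟨t, n, hn, ht.symm⟩
  · intro h f hf
    have hfx : f = fun s => f 1 * s := by
      funext s
      have h1 := hf 1 s
      simpa using h1
    obtain ⟨t, n, hn, ht⟩ := h 1 (f 1)
    refine ⟨n, hn, ?_⟩
    rw [hfx]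
    ext y
    constructor
    · rintro ⟨s, rfl⟩
      refine ⟨t * s, ?_⟩
      rw [key, key, ← mul_assoc, ← ht, mul_one]
    · rintro ⟨s, rfl⟩
      refine ⟨f 1 * s, ?_⟩
      rw [key, key, pow_succ, mul_assoc]
end
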